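/- Let f : U \ D → ℂ be a holomorphic function on the complement of a closed analytic subset D of codimension ≥ 2 in an open set U ⊆ ℂⁿ. Then f extends uniquely to a holomorphic function on U. -/

import Mathlib

open Set
open Filter Topology MeasureTheory


open scoped NNReal ENNReal in
lemma aux_local_int {W : Type*} [NormedAddCommGroup W] [NormedSpace ℂ W] [MeasurableSpace W]
    [BorelSpace W] [SecondCountableTopology W] (H : W → ℂ) (w0 : W) (h : AnalyticAt ℂ H w0)
    (μ : Measure W) [IsFiniteMeasure μ] :
    ∃ t ∈ 𝓝 w0, MeasurableSet t ∧
      (∀ᶠ z in 𝓝 (0 : W), IntegrableOn (fun w => H (z + w)) t μ) ∧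
      ∀ s ⊆ t, MeasurableSet s → AnalyticAt ℂ (fun z => ∫ w in s, H (z + w) ∂μ) 0 := by
  obtain ⟨p, r, hp⟩ := h
  obtain ⟨ρ, hρ0, hρ⟩ : ∃ ρ : ℝ≥0, 0 < ρ ∧ (ρ + ρ : ℝ≥0∞) < r := by
    obtain ⟨a, ha0, har⟩ := ENNReal.lt_iff_exists_nnreal_btwn.1 hp.r_pos
    refine ⟨a / 2, by simpa using ha0, ?_⟩
    have : ((a / 2 : ℝ≥0) : ℝ≥0∞) + (a / 2 : ℝ≥0) = a := by
      rw [← ENNReal.coe_add, add_halves]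
    rwa [this]
  have hρr : (ρ + ρ : ℝ≥0∞) < p.radius := hρ.trans_le hp.r_le
  have hρ1 : (ρ : ℝ≥0∞) < p.radius := lt_of_le_of_lt (by simp) hρr
  set q : W → FormalMultilinearSeries ℂ W ℂ := fun w => p.changeOrigin (w - w0) with hq
  set B : ℕ → ℝ≥0 := fun k =>
    ∑' s : Σ l : ℕ, { s : Finset (Fin (k + l)) // s.card = l }, ‖p (k + s.1)‖₊ * ρ ^ s.1 with hB
  have hBs : Summable fun k => B k * ρ ^ k := by
    have := (NNReal.summable_sigma.1 (p.changeOriginSeries_summable_aux₁ hρr)).2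
    simpa only [NNReal.tsum_mul_right] using this
  have hn : ∀ w ∈ Metric.ball w0 (ρ : ℝ), ‖w - w0‖₊ < ρ := fun w hw => by
    rw [mem_ball_iff_norm] at hw; exact_mod_cast hw
  have hqB : ∀ w ∈ Metric.ball w0 (ρ : ℝ), ∀ k, ‖q w k‖₊ ≤ B k := by
    intro w hw k
    have h1 := hn w hw
    have h2 : (‖w - w0‖₊ : ℝ≥0∞) < p.radius := lt_trans (by exact_mod_cast h1) hρ1
    refine (p.nnnorm_changeOrigin_le k h2).trans ?_
    refine (p.changeOriginSeries_summable_aux₂ h2 k).tsum_le_tsum (fun s => ?_)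
      (p.changeOriginSeries_summable_aux₂ hρ1 k)
    gcongr
  have hqc : ∀ k, ContinuousOn (fun w => q w k) (Metric.ball w0 (ρ : ℝ)) := by
    intro k
    have h1 := (p.hasFPowerSeriesOnBall_changeOrigin k (lt_of_le_of_lt zero_le hρ1)).continuousOn
    refine h1.comp (f := fun w => w - w0) (by fun_prop) ?_
    intro w hw
    rw [mem_eball_zero_iff]
    refine lt_trans ?_ hρ1
    have := hn w hw
    rw [enorm_eq_nnnorm]
    exact_mod_cast this
  have hsum : ∀ w ∈ Metric.ball w0 (ρ : ℝ), ∀ z ∈ Metric.eball (0 : W) ρ,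
      HasSum (fun n => q w n fun _ => z) (H (z + w)) := by
    intro w hw z hz
    have h1 := hn w hw
    have h2 : (‖w - w0‖₊ : ℝ≥0∞) < ρ := by exact_mod_cast h1
    have h3 := hp.changeOrigin (y := w - w0) (h2.trans (lt_of_le_of_lt (by simp) hρ))
    have h4 := h3.hasSum (y := z) (by
      refine Metric.eball_subset_eball ?_ hz
      refine ENNReal.le_sub_of_add_le_right (by simp) ?_
      refine le_trans ?_ hρ.le
      gcongr)
    simpa [add_comm] using h4
  have hqint : ∀ s ⊆ Metric.ball w0 (ρ : ℝ), MeasurableSet s → ∀ k,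
      IntegrableOn (fun w => q w k) s μ := by
    intro s hs hsm k
    refine IntegrableOn.of_bound (measure_lt_top _ _)
      (((hqc k).mono hs).aestronglyMeasurable hsm) (B k) ?_
    filter_upwards [ae_restrict_mem hsm] with w hw
    exact_mod_cast hqB w (hs hw) k
  have hball : Metric.eball (0 : W) ρ ∈ 𝓝 (0 : W) :=
    Metric.eball_mem_nhds _ (by exact_mod_cast hρ0)
  refine ⟨Metric.ball w0 ρ, Metric.ball_mem_nhds _ (by exact_mod_cast hρ0), measurableSet_ball,
    ?_, ?_⟩
  · filter_upwards [hball] with z hz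
    have hc : ContinuousOn (fun w => H (z + w)) (Metric.ball w0 (ρ : ℝ)) := by
      refine hp.continuousOn.comp (f := fun w => z + w) (by fun_prop) ?_
      intro w hw
      rw [mem_eball_zero_iff] at hz
      have h2 : ‖w - w0‖ₑ < ρ := by 
        have := hn w hw
        rw [enorm_eq_nnnorm]; exact_mod_cast this
      rw [Metric.mem_eball, edist_eq_enorm_sub]
      calc ‖z + w - w0‖ₑ = ‖z + (w - w0)‖ₑ := by rw [add_sub_assoc]
        _ ≤ ‖z‖ₑ + ‖w - w0‖ₑ := enorm_add_le _ _
        _ < ρ + ρ := ENNReal.add_lt_add hz h2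
        _ < r := hρ
    refine IntegrableOn.of_bound (measure_lt_top _ _)
      (hc.aestronglyMeasurable measurableSet_ball) (∑' k, (B k * ρ ^ k : ℝ≥0)) ?_
    filter_upwards [ae_restrict_mem measurableSet_ball] with w hw
    rw [← (hsum w hw z hz).tsum_eq]
    refine tsum_of_norm_bounded (NNReal.summable_coe.2 hBs).hasSum fun k => ?_
    refine ((q w k).le_opNorm _).trans ?_
    rw [mem_eball_zero_iff, enorm_eq_nnnorm] at hz
    have hz' : ‖z‖₊ ≤ ρ := by exact_mod_cast hz.le
    simp only [Finset.prod_const, Finset.card_univ, Fintype.card_fin]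
    have := hqB w hw k
    exact_mod_cast mul_le_mul' this (pow_le_pow_left' hz' k)
  · intro s hs hsm
    let Q : FormalMultilinearSeries ℂ W ℂ := fun k => ∫ w in s, q w k ∂μ
    have hQ : HasFPowerSeriesOnBall (fun z => ∫ w in s, H (z + w) ∂μ) Q 0 ρ := by
      refine ⟨?_, by exact_mod_cast hρ0, ?_⟩
      · refine Q.le_radius_of_bound (μ.real s * ∑' k, (B k * ρ ^ k : ℝ≥0)) fun n => ?_
        have h1 : ‖Q n‖ ≤ B n * μ.real s := by
          refine norm_setIntegral_le_of_norm_le_const (measure_lt_top _ _) ?_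
          intro w hw
          exact_mod_cast hqB w (hs hw) n
        have h2 : ((B n * ρ ^ n : ℝ≥0) : ℝ) ≤ (∑' k, (B k * ρ ^ k : ℝ≥0) : ℝ≥0) :=
          NNReal.coe_le_coe.2 (hBs.le_tsum' n)
        calc ‖Q n‖ * (ρ : ℝ) ^ n ≤ B n * μ.real s * (ρ : ℝ) ^ n := by gcongr
          _ = μ.real s * ((B n * ρ ^ n : ℝ≥0) : ℝ) := by push_cast; ring
          _ ≤ _ := by gcongr
      · intro z hz
        have hz2 := hz
        rw [mem_eball_zero_iff, enorm_eq_nnnorm] at hz2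
        have hz' : ‖z‖₊ ≤ ρ := by exact_mod_cast hz2.le
        have hb : ∀ w ∈ s, ∀ k, ‖q w k fun _ => z‖ ≤ (B k * ρ ^ k : ℝ≥0) := by
          intro w hw k
          refine ((q w k).le_opNorm _).trans ?_
          simp only [Finset.prod_const, Finset.card_univ, Fintype.card_fin]
          exact_mod_cast mul_le_mul' (hqB w (hs hw) k) (pow_le_pow_left' hz' k)
        have hi : ∀ k, IntegrableOn (fun w => q w k fun _ => z) s μ := by
          intro k
          exact (ContinuousMultilinearMap.apply ℂ (fun _ : Fin k => W) ℂ (fun _ => z)).integrable_comp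
            (hqint s hs hsm k)
        have h1 := MeasureTheory.hasSum_integral_of_summable_integral_norm
          (μ := μ.restrict s) (F := fun k w => q w k fun _ => z) hi (by
            refine Summable.of_nonneg_of_le (fun k => integral_nonneg fun _ => norm_nonneg _)
              (fun k => ?_) ((NNReal.summable_coe.2 hBs).mul_right (μ.real s))
            refine (le_abs_self _).trans ?_
            refine norm_setIntegral_le_of_norm_le_const (f := fun w => ‖q w k fun _ => z‖) (measure_lt_top _ _) ?_
            intro w hw
            rw [norm_norm]; exact hb w hw k)
        have h2 : ∫ w in s, ∑' k, (q w k fun _ => z) ∂μ = ∫ w in s, H (0 + z + w) ∂μ := by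
          refine setIntegral_congr_fun hsm fun w hw => ?_
          simp only [zero_add]
          exact (hsum w (hs hw) z hz).tsum_eq
        rw [h2] at h1
        convert h1 using 2 with k
        exact ContinuousMultilinearMap.integral_apply (hqint s hs hsm k) _
    exact hQ.analyticAt

lemma aux_int {W : Type*} [NormedAddCommGroup W] [NormedSpace ℂ W] [MeasurableSpace W]
    [BorelSpace W] [SecondCountableTopology W] (H : W → ℂ) (K : Set W) (hK : IsCompact K)
    (h : ∀ w ∈ K, AnalyticAt ℂ H w)
    (μ : Measure W) [IsFiniteMeasure μ] :
    AnalyticAt ℂ (fun z => ∫ w in K, H (z + w) ∂μ) 0 := by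
  have key : ∃ t, K ⊆ t ∧ MeasurableSet t ∧
      (∀ᶠ z in 𝓝 (0 : W), IntegrableOn (fun w => H (z + w)) t μ) ∧
      ∀ s ⊆ t, MeasurableSet s → AnalyticAt ℂ (fun z => ∫ w in s, H (z + w) ∂μ) 0 := by
    refine hK.induction_on (p := fun K => ∃ t, K ⊆ t ∧ MeasurableSet t ∧
      (∀ᶠ z in 𝓝 (0 : W), IntegrableOn (fun w => H (z + w)) t μ) ∧
      ∀ s ⊆ t, MeasurableSet s → AnalyticAt ℂ (fun z => ∫ w in s, H (z + w) ∂μ) 0) ?_ ?_ ?_ ?_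
    · refine ⟨∅, subset_rfl, MeasurableSet.empty, by simp, fun s hs _ => ?_⟩
      rw [subset_empty_iff.1 hs]
      simpa using analyticAt_const
    · rintro s t hst ⟨t', h1, h2⟩
      exact ⟨t', hst.trans h1, h2⟩
    · rintro s1 s2 ⟨t1, a1, b1, c1, d1⟩ ⟨t2, a2, b2, c2, d2⟩
      refine ⟨t1 ∪ t2, union_subset_union a1 a2, b1.union b2, ?_, ?_⟩
      · filter_upwards [c1, c2] with z h1 h2 using h1.union h2
      · intro s hs hsm
        have e1 : s \ t1 ⊆ t2 := by
          intro x hx; exact (hs hx.1).resolve_left hx.2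
        have A := (d1 (s ∩ t1) inter_subset_right (hsm.inter b1)).add
          (d2 (s \ t1) e1 (hsm.diff b1))
        refine A.congr ?_
        filter_upwards [c1, c2] with z h1 h2
        have := setIntegral_union (f := fun w => H (z + w)) (μ := μ)
          (disjoint_sdiff_inter (s := s) (t := t1)).symm (hsm.diff b1)
          (h1.mono_set inter_subset_right) (h2.mono_set e1)
        rw [inter_union_sdiff] at this
        exact this.symm
    · intro w hw
      obtain ⟨t, ht, a, b, c⟩ := aux_local_int H w (h w hw) μ
      exact ⟨t, mem_nhdsWithin_of_mem_nhds ht, t, subset_rfl, a, b, c⟩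
  obtain ⟨t, hKt, _, _, h4⟩ := key
  exact h4 K hKt hK.measurableSet

lemma aux_ext_local {E : Type*} [NormedAddCommGroup E] [NormedSpace ℂ E] [FiniteDimensional ℂ E]
    (U D : Set E) (hU : IsOpen U) (hUD : IsOpen (U \ D)) (f : E → ℂ)
    (hf : AnalyticOnNhd ℂ f (U \ D)) (p : E) (hp : p ∈ U) (l : E →L[ℂ] ℂ) (v : E)
    (hline : ∀ t : ℂ, t ≠ 0 → p + t • v ∉ D)
    (hdense : Dense {x : E | ∀ t : ℂ, x + t • v ∉ D}) :
    ∃ g : E → ℂ, AnalyticAt ℂ g p ∧ ∀ᶠ x in 𝓝 p, x ∉ D → g x = f x := by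
  obtain ⟨r, hr0, hr⟩ : ∃ r : ℝ, 0 < r ∧ ∀ t ∈ Metric.closedBall (0 : ℂ) r, p + t • v ∈ U := by
    have h1 : ∀ᶠ t in 𝓝 (0 : ℂ), p + t • v ∈ U := by
      have : ContinuousAt (fun t : ℂ => p + t • v) 0 := by fun_prop
      exact this.eventually_mem (hU.mem_nhds (by simpa using hp))
    obtain ⟨r, hr0, hr⟩ := Metric.nhds_basis_closedBall.eventually_iff.1 h1
    exact ⟨r, hr0, fun t ht => hr ht⟩
  have hcA : Continuous (fun z : E × ℂ => z.1 + (z.2 - l (z.1 - p)) • v) := by fun_prop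
  have N1 : ∀ᶠ x in 𝓝 p, ∀ t ∈ Metric.closedBall (0 : ℂ) r, x + (t - l (x - p)) • v ∈ U := by
    refine (isCompact_closedBall (0 : ℂ) r).eventually_forall_of_forall_eventually
      (P := fun x t => x + (t - l (x - p)) • v ∈ U) fun t ht => ?_
    exact hcA.continuousAt.eventually_mem (hU.mem_nhds (by simpa using hr t ht))
  have hS : ∀ t ∈ Metric.sphere (0 : ℂ) r, p + t • v ∈ U \ D := fun t ht =>
    ⟨hr t (Metric.sphere_subset_closedBall ht), hline t (ne_zero_of_mem_sphere hr0.ne' ⟨t, ht⟩)⟩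
  have N2 : ∀ᶠ x in 𝓝 p, ∀ t ∈ Metric.sphere (0 : ℂ) r, x + (t - l (x - p)) • v ∈ U \ D := by
    refine (isCompact_sphere (0 : ℂ) r).eventually_forall_of_forall_eventually
      (P := fun x t => x + (t - l (x - p)) • v ∈ U \ D) fun t ht => ?_
    exact hcA.continuousAt.eventually_mem (hUD.mem_nhds (by simpa using hS t ht))
  have N3 : ∀ᶠ x in 𝓝 p, l (x - p) ∈ Metric.ball (0 : ℂ) r := by
    have : ContinuousAt (fun x : E => l (x - p)) p := by fun_prop
    exact this.eventually_mem (Metric.isOpen_ball.mem_nhds (by simpa using hr0))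
  let H : E × ℂ → ℂ := fun y =>
    y.2 * Complex.I * ((y.2 - l (y.1 - p))⁻¹ * f (y.1 + (y.2 - l (y.1 - p)) • v))
  have hH : ∀ y : E × ℂ, y.2 - l (y.1 - p) ≠ 0 → y.1 + (y.2 - l (y.1 - p)) • v ∈ U \ D →
      AnalyticAt ℂ H y := by
    intro y h1 h2
    have a1 : AnalyticAt ℂ (fun y : E × ℂ => y.1) y := analyticAt_fst
    have a2 : AnalyticAt ℂ (fun y : E × ℂ => y.2) y := analyticAt_snd
    have a3 : AnalyticAt ℂ (fun y : E × ℂ => y.2 - l (y.1 - p)) y :=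
      a2.sub ((l.analyticAt _).fun_comp (a1.sub analyticAt_const))
    have a4 : AnalyticAt ℂ (fun y : E × ℂ => y.1 + (y.2 - l (y.1 - p)) • v) y :=
      a1.add (a3.smul analyticAt_const)
    exact (a2.mul analyticAt_const).mul ((a3.inv h1).mul (AnalyticAt.comp (g := f)
      (f := fun y : E × ℂ => y.1 + (y.2 - l (y.1 - p)) • v) (hf _ h2) a4))
  let γ : ℝ → E × ℂ := fun θ => (p, circleMap 0 r θ)
  have hγ : Continuous γ := by fun_prop
  borelize E
  have : ProperSpace E := FiniteDimensional.proper ℂ E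
  have : SecondCountableTopology E := inferInstance
  let μ : Measure (E × ℂ) := Measure.map γ (volume.restrict (Ioc 0 (2 * Real.pi)))
  let K : Set (E × ℂ) := {p} ×ˢ Metric.sphere (0 : ℂ) r
  have hK : IsCompact K := isCompact_singleton.prod (isCompact_sphere _ _)
  have hγK : ∀ θ, γ θ ∈ K := fun θ => ⟨rfl, circleMap_mem_sphere _ hr0.le _⟩
  have hμK : μ.restrict K = μ := by
    refine Measure.restrict_eq_self_of_ae_mem ?_
    exact (ae_map_iff (p := fun y => y ∈ K) hγ.aemeasurable hK.measurableSet).2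
      (Eventually.of_forall hγK)
  have A0 := aux_int H K hK (fun y hy => by
    obtain ⟨y1, y2⟩ := y
    obtain ⟨rfl, hy2⟩ := hy
    refine hH _ ?_ ?_
    · simpa using ne_zero_of_mem_sphere hr0.ne' ⟨y2, hy2⟩
    · simpa using hS y2 hy2) μ
  have A1 : AnalyticAt ℂ (fun x : E => ∫ w in K, H ((x - p, 0) + w) ∂μ) p := by
    have b : AnalyticAt ℂ (fun x : E => ((x - p, 0) : E × ℂ)) p :=
      (analyticAt_id.sub analyticAt_const).prod analyticAt_const
    exact AnalyticAt.comp_of_eq (g := fun z : E × ℂ => ∫ w in K, H (z + w) ∂μ)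
      (f := fun x : E => ((x - p, 0) : E × ℂ)) A0 b (by simp)
  let g : E → ℂ := fun x => (2 * Real.pi * Complex.I : ℂ)⁻¹ *
    ∮ t in C(0, r), (t - l (x - p))⁻¹ • f (x + (t - l (x - p)) • v)
  have hg : AnalyticAt ℂ g p := by
    refine (analyticAt_const (v := (2 * Real.pi * Complex.I : ℂ)⁻¹)).mul A1 |>.congr ?_
    filter_upwards [N2, N3] with x h2 h3
    simp only [g, Pi.mul_apply]
    congr 1
    have hm : AEStronglyMeasurable (fun w => H ((x - p, 0) + w)) μ := by
      rw [← hμK]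
      refine ContinuousOn.aestronglyMeasurable ?_ hK.measurableSet
      rintro ⟨y1, y2⟩ ⟨rfl, hy⟩
      refine ContinuousAt.continuousWithinAt ?_
      have : ContinuousAt H ((x - y1, 0) + (y1, y2)) := by
        refine (hH _ ?_ ?_).continuousAt
        · simp only [Prod.mk_add_mk, sub_add_cancel, zero_add]
          intro h0
          rw [sub_eq_zero] at h0
          rw [← h0] at h3
          simp at h3 hy
          exact h3.ne hy
        · simpa using h2 y2 hy
      exact ContinuousAt.comp this (by fun_prop)
    rw [hμK, integral_map hγ.aemeasurable hm, circleIntegral,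
      intervalIntegral.integral_of_le (by positivity)]
    refine integral_congr_ae (Eventually.of_forall fun θ => ?_)
    simp [H, γ, mul_assoc]
  refine ⟨g, hg, ?_⟩
  have Eq : ∀ᶠ x in 𝓝 p, (∀ t : ℂ, x + t • v ∉ D) → g x = f x := by
    filter_upwards [N1, N3] with x h1 h3 hx
    have hd : DifferentiableOn ℂ (fun t : ℂ => f (x + (t - l (x - p)) • v))
        (Metric.closedBall 0 r) := by
      intro t ht
      have : DifferentiableAt ℂ f (x + (t - l (x - p)) • v) :=
        (hf _ ⟨h1 t ht, hx _⟩).differentiableAt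
      refine DifferentiableAt.differentiableWithinAt ?_
      exact DifferentiableAt.comp (f := fun t : ℂ => x + (t - l (x - p)) • v) t this (by fun_prop)
    simp only [g]
    rw [hd.circleIntegral_sub_inv_smul h3]
    rw [smul_eq_mul, inv_mul_cancel_left₀ Complex.two_pi_I_ne_zero]
    simp
  filter_upwards [Eq.eventually_nhds, hg.eventually_analyticAt, hU.mem_nhds hp] with x hE hgx hxU hxD
  have hfx : ContinuousAt f x := (hf x ⟨hxU, hxD⟩).continuousAt
  have ht : Tendsto (fun y => g y - f y) (𝓝 x) (𝓝 (g x - f x)) :=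
    (hgx.continuousAt.sub hfx).tendsto
  have hfr : ∃ᶠ y in 𝓝 x, y ∈ {x : E | ∀ t : ℂ, x + t • v ∉ D} :=
    mem_closure_iff_frequently.1 (hdense x)
  have := isClosed_singleton.mem_of_frequently_of_tendsto (s := {(0 : ℂ)})
    ((hfr.and_eventually hE).mono fun y hy => by
      simp [hy.2 hy.1]) ht
  simpa [sub_eq_zero] using this

lemma aux_dir {E : Type*} [NormedAddCommGroup E] [NormedSpace ℂ E] [FiniteDimensional ℂ E]
    (D : Set E) (l : E →L[ℂ] ℂ) (e : E) (he : l e = 1) (p : E)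
    (hD : dimH D < Module.finrank ℝ l.ker) :
    ∃ v : E, (∀ t : ℂ, t ≠ 0 → p + t • v ∉ D) ∧ Dense {x : E | ∀ t : ℂ, x + t • v ∉ D} := by
  have : ProperSpace E := FiniteDimensional.proper ℂ E
  have : SecondCountableTopology E := inferInstance
  have proj : ∀ v : E, l v = 1 → ∃ P : E →L[ℂ] l.ker, ∀ x, (P x : E) = x - l x • v := by
    intro v hv
    refine ⟨(ContinuousLinearMap.id ℂ E - l.smulRight v).codRestrict l.ker ?_, ?_⟩
    · intro x
      simp [hv]
    · intro x; simp
  obtain ⟨P0, hP0⟩ := proj e he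
  let φ : E → l.ker := fun x => (l (x - p))⁻¹ • P0 (x - p)
  let D' : Set E := D ∩ {x | l (x - p) ≠ 0}
  have h1 : dimH (φ '' D') ≤ dimH D := by
    refine le_trans (dimH_image_le_of_locally_lipschitzOn ?_) (dimH_mono inter_subset_left)
    intro x hx
    have : ContDiffAt ℂ 1 φ x := by
      have c1 : ContDiffAt ℂ 1 (fun x => l (x - p)) x := by fun_prop
      have c2 : ContDiffAt ℂ 1 (fun x => P0 (x - p)) x := by fun_prop
      exact (c1.inv hx.2).smul c2
    obtain ⟨C, t, ht, hC⟩ := this.exists_lipschitzOnWith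
    exact ⟨C, t, mem_nhdsWithin_of_mem_nhds ht, hC⟩
  obtain ⟨v', hv'⟩ := (dense_compl_of_dimH_lt_finrank (h1.trans_lt hD)).nonempty
  have hlv' : l (v' : E) = 0 := v'.2
  have hlv : l (e + v') = 1 := by simp [he, hlv']
  refine ⟨e + v', ?_, ?_⟩
  · intro t ht hD
    refine hv' ⟨p + t • (e + v'), ⟨hD, ?_⟩, ?_⟩
    · simp [he, hlv', ht]
    · ext
      simp [φ, hP0, he, hlv']
      simp [ht]
  · obtain ⟨P, hP⟩ := proj (e + v') hlv
    have h2 : dimH (P '' D) ≤ dimH D := P.lipschitz.dimH_image_le D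
    have h3 := dense_compl_of_dimH_lt_finrank (h2.trans_lt hD)
    have hsurj : Function.Surjective P := by
      intro y
      refine ⟨y, ?_⟩
      ext
      have : l (y : E) = 0 := y.2
      simp [hP, this]
    refine (h3.preimage (P.isOpenMap hsurj)).mono ?_
    intro x hx t hxt
    refine hx ⟨_, hxt, ?_⟩
    ext
    rw [hP, hP]
    rw [map_add, map_smul, hlv]
    simp [add_smul]
    abel

theorem hartogs_extension_across_codim_two
    (n : ℕ) (U D : Set (EuclideanSpace ℂ (Fin n)))
    (hU : IsOpen U) (hDU : D ⊆ U)
    -- D is closed in U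
    (hDclosed : IsClosed (Subtype.val ⁻¹' D : Set U))
    -- D is an analytic subset: locally the common zero set of holomorphic functions
    (hDan : ∀ x ∈ U, ∃ V : Set (EuclideanSpace ℂ (Fin n)), V ⊆ U ∧ IsOpen V ∧ x ∈ V ∧
      ∃ (k : ℕ) (g : Fin k → EuclideanSpace ℂ (Fin n) → ℂ),
        (∀ i, AnalyticOnNhd ℂ (g i) V) ∧ D ∩ V = {y ∈ V | ∀ i, g i y = 0})
    -- D has complex codimension at least 2 in ℂⁿ
    (hdim : D = ∅ ∨ ∃ d : ℕ, d + 2 ≤ n ∧ dimH D ≤ 2 * d)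
    (f : EuclideanSpace ℂ (Fin n) → ℂ) (hf : AnalyticOnNhd ℂ f (U \ D)) :
    ∃ g : EuclideanSpace ℂ (Fin n) → ℂ,
      (AnalyticOnNhd ℂ g U ∧ EqOn g f (U \ D)) ∧
      ∀ g' : EuclideanSpace ℂ (Fin n) → ℂ,
        AnalyticOnNhd ℂ g' U → EqOn g' f (U \ D) → EqOn g' g U := by
  rcases hdim with rfl | ⟨d, hd, hdim⟩
  · simp only [sdiff_empty] at hf ⊢
    exact ⟨f, ⟨hf, fun _ _ => rfl⟩, fun g' _ h => h⟩
  have hUD : IsOpen (U \ D) := by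
    have := hU.isOpenMap_subtype_val _ hDclosed.isOpen_compl
    convert this using 1
    ext x; simp
  have hDd : Dense Dᶜ := by
    refine dense_compl_of_dimH_lt_finrank (hdim.trans_lt ?_)
    rw [finrank_real_of_complex, finrank_euclideanSpace_fin]
    exact_mod_cast (by omega : 2 * d < 2 * n)
  have loc : ∀ p ∈ U, ∃ g : EuclideanSpace ℂ (Fin n) → ℂ,
      AnalyticAt ℂ g p ∧ ∀ᶠ x in 𝓝 p, x ∉ D → g x = f x := by
    intro p hp
    let j : Fin n := ⟨0, by omega⟩
    let l : EuclideanSpace ℂ (Fin n) →L[ℂ] ℂ := EuclideanSpace.proj j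
    let e : EuclideanSpace ℂ (Fin n) := EuclideanSpace.single j 1
    have he : l e = 1 := by simp [l, e]
    have hfr : Module.finrank ℂ l.ker + 1 = n := by
      have h1 := LinearMap.finrank_range_add_finrank_ker (l : EuclideanSpace ℂ (Fin n) →ₗ[ℂ] ℂ)
      have h2 : LinearMap.range (l : EuclideanSpace ℂ (Fin n) →ₗ[ℂ] ℂ) = ⊤ := by
        rw [LinearMap.range_eq_top]
        intro c
        exact ⟨c • e, by simp [he]⟩
      rw [h2, finrank_top, Module.finrank_self, finrank_euclideanSpace_fin] at h1
      rw [add_comm]; exact h1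
    obtain ⟨v, h1, h2⟩ := aux_dir D l e he p (by
      refine hdim.trans_lt ?_
      rw [finrank_real_of_complex]
      exact_mod_cast (by omega : 2 * d < 2 * Module.finrank ℂ l.ker))
    exact aux_ext_local U D hU hUD f hf p hp l v h1 h2
  have uniq : ∀ g1 g2 : EuclideanSpace ℂ (Fin n) → ℂ, ∀ x, ContinuousAt g1 x → ContinuousAt g2 x →
      (∀ᶠ y in 𝓝 x, y ∉ D → g1 y = g2 y) → g1 x = g2 x := by
    intro g1 g2 x h1 h2 h
    have hfr : ∃ᶠ y in 𝓝 x, y ∈ Dᶜ := mem_closure_iff_frequently.1 (hDd x)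
    have := isClosed_singleton.mem_of_frequently_of_tendsto (s := {(0 : ℂ)})
      ((hfr.and_eventually h).mono fun y hy => by
        simp [hy.2 hy.1]) (h1.sub h2).tendsto
    simpa [sub_eq_zero] using this
  choose! G hG1 hG2 using loc
  have hGf : ∀ x ∈ U, x ∉ D → G x x = f x := fun x hx hxD => (hG2 x hx).self_of_nhds hxD
  refine ⟨fun x => G x x, ⟨?_, fun x hx => hGf x hx.1 hx.2⟩, ?_⟩
  · intro p hp
    refine (hG1 p hp).congr ?_
    filter_upwards [(hG1 p hp).eventually_analyticAt, (hG2 p hp).eventually_nhds,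
      hU.mem_nhds hp] with x h1 h2 hx
    refine uniq _ _ x h1.continuousAt (hG1 x hx).continuousAt ?_
    filter_upwards [h2, hG2 x hx] with y a b hy
    rw [a hy, b hy]
  · intro g' hg' he x hx
    refine uniq _ _ x (hg' x hx).continuousAt (hG1 x hx).continuousAt ?_
    filter_upwards [hG2 x hx, hU.mem_nhds hx] with y a b hy
    rw [a hy, he ⟨b, hy⟩]
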